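/- Let q > 1 and let H ∈ BH(n,q) be a Butson Hadamard matrix. Suppose 𝐱 ∈ ℂ^n has all entries q-th roots of unity and is a bent vector for H with root-of-unity dual, i.e., for every row 𝐰 of H the Hermitian inner product ⟨𝐱,𝐰⟩ = Σ_i x_i·conj(w_i) equals √n·ζ for some q-th root of unity ζ. Then for every codeword 𝐜 of the Butson Hadamard code C_H, the scaled homogeneous distance satisfies d(L(𝐱), 𝐜) ≥ φ(q)·(n − √n); consequently the covering radius of C_H for the scaled homogeneous distance satisfies r(C_H) ≥ φ(q)·(n − √n). -/

import Mathlib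

/-- `ζ_q^x = exp(2πi·x/q)` for `x ∈ ℤ/q`. -/
noncomputable def zetaPow (q : ℕ) (x : ZMod q) : ℂ :=
  Complex.exp (2 * Real.pi * Complex.I * x.val / q)

/-- The scaled homogeneous weight on `ℤ/q` (normalization `λ = φ(q)`), a real number:
`wt(x) = φ(q) − ∑_{a ∈ (ℤ/q)ˣ} ζ_q^{a·x}` (the sum is real, so we take its real part). -/
noncomputable def wtHom (q : ℕ) [NeZero q] (x : ZMod q) : ℝ :=
  (Nat.totient q : ℝ) - (∑ a : (ZMod q)ˣ, zetaPow q ((a : ZMod q) * x)).re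

/-- The scaled homogeneous distance between two vectors in `(ℤ/q)^n`. -/
noncomputable def homDist (q n : ℕ) [NeZero q] (u v : Fin n → ZMod q) : ℝ :=
  ∑ i, wtHom q (u i - v i)

/-- The Butson Hadamard code attached to the logarithmic form `LH` of a Butson
Hadamard matrix: all vectors `L(𝐰) + α·𝟏` with `𝐰` a row of `H` and `α ∈ ℤ/q`. -/
def BHCode (q n : ℕ) (LH : Fin n → Fin n → ZMod q) : Set (Fin n → ZMod q) :=
  {c | ∃ (i : Fin n) (α : ZMod q), c = fun j => LH i j + α}

/-- The covering radius of a code `C ⊆ (ℤ/q)^n` for the scaled homogeneous distance. -/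
noncomputable def covRad (q n : ℕ) [NeZero q] (C : Set (Fin n → ZMod q)) : ℝ :=
  ⨆ x : Fin n → ZMod q, ⨅ c : C, homDist q n x c

theorem zetaPow_eq_stdAddChar {q : ℕ} [NeZero q] (x : ZMod q) :
    zetaPow q x = ZMod.stdAddChar x := by
  rw [zetaPow, ZMod.stdAddChar_apply, ZMod.toCircle_apply]

theorem isPrimitiveRoot_stdAddChar {q : ℕ} [NeZero q] (a : (ZMod q)ˣ) :
    IsPrimitiveRoot (ZMod.stdAddChar (a : ZMod q)) q := by
  refine IsPrimitiveRoot.mk_of_lt _ (NeZero.pos q) ?_ fun l hl hlq h => ?_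
  · rw [← AddChar.map_nsmul_eq_pow]
    simp
  · rw [← AddChar.map_nsmul_eq_pow, ← AddChar.map_zero_eq_one (ZMod.stdAddChar (N := q)),
      ZMod.injective_stdAddChar.eq_iff, nsmul_eq_mul, Units.mul_left_eq_zero,
      ZMod.natCast_eq_zero_iff] at h
    exact absurd (Nat.le_of_dvd hl h) (by lia)

/-- Galois conjugation preserves the vanishing of integer polynomials at primitive roots. -/
theorem IsPrimitiveRoot.aeval_eq_zero_of_isPrimitiveRoot {q : ℕ} [NeZero q] {μ ν : ℂ}
    (hμ : IsPrimitiveRoot μ q) (hν : IsPrimitiveRoot ν q) {p : Polynomial ℤ}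
    (hp : Polynomial.aeval μ p = 0) : Polynomial.aeval ν p = 0 := by
  have hdvd : minpoly ℤ μ ∣ p :=
    minpoly.isIntegrallyClosed_dvd (hμ.isIntegral (NeZero.pos q)) hp
  rw [← Polynomial.cyclotomic_eq_minpoly hμ (NeZero.pos q),
    Polynomial.cyclotomic_eq_minpoly hν (NeZero.pos q)] at hdvd
  exact Polynomial.aeval_eq_zero_of_dvd_aeval_eq_zero hdvd (minpoly.aeval ℤ ν)

theorem stdAddChar_mul_eq_pow {q : ℕ} [NeZero q] (a x : ZMod q) :
    ZMod.stdAddChar (a * x) = ZMod.stdAddChar a ^ x.val := by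
  rw [← AddChar.map_nsmul_eq_pow, nsmul_eq_mul, ZMod.natCast_val, ZMod.cast_id, mul_comm]

theorem sum_stdAddChar_mul_conj {q : ℕ} [NeZero q] {ι : Type*} [Fintype ι]
    (d : ι → ZMod q) (a : ZMod q) :
    (∑ j, ZMod.stdAddChar (a * d j)) * (starRingEnd ℂ) (∑ j, ZMod.stdAddChar (a * d j)) =
      ∑ j, ∑ k, ZMod.stdAddChar a ^ (d j - d k).val := by
  rw [map_sum, Finset.sum_mul_sum]
  refine Finset.sum_congr rfl fun j _ => Finset.sum_congr rfl fun k _ => ?_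
  rw [← stdAddChar_mul_eq_pow, ← AddChar.map_neg_eq_conj, ← AddChar.map_add_eq_mul]
  congr 1
  ring

/-- If a sum of `q`-th roots of unity has squared modulus an integer, so do its conjugates. -/
theorem norm_sq_sum_stdAddChar_unit_mul {q : ℕ} [NeZero q] {ι : Type*} [Fintype ι]
    (d : ι → ZMod q) {m : ℕ} (h : ‖∑ j, ZMod.stdAddChar (d j)‖ ^ 2 = m) (a : (ZMod q)ˣ) :
    ‖∑ j, ZMod.stdAddChar ((a : ZMod q) * d j)‖ ^ 2 = m := by
  have key (b : (ZMod q)ˣ) : ‖∑ j, ZMod.stdAddChar ((b : ZMod q) * d j)‖ ^ 2 = m ↔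
      Polynomial.aeval (ZMod.stdAddChar (b : ZMod q))
        (∑ j, ∑ k, Polynomial.X ^ (d j - d k).val - (m : Polynomial ℤ)) = 0 := by
    rw [map_sub, map_sum]
    simp_rw [map_sum, map_pow, Polynomial.aeval_X, map_natCast]
    rw [← sum_stdAddChar_mul_conj, Complex.mul_conj', sub_eq_zero]
    norm_cast
  rw [key]
  refine (isPrimitiveRoot_stdAddChar 1).aeval_eq_zero_of_isPrimitiveRoot
    (isPrimitiveRoot_stdAddChar a) ?_
  rw [← key]
  simpa using h

theorem homDist_eq {q n : ℕ} [NeZero q] (u v : Fin n → ZMod q) :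
    homDist q n u v = Nat.totient q * n -
      ∑ a : (ZMod q)ˣ, (∑ j, ZMod.stdAddChar ((a : ZMod q) * (u j - v j))).re := by
  simp_rw [homDist, wtHom, zetaPow_eq_stdAddChar, Finset.sum_sub_distrib, Complex.re_sum]
  rw [Finset.sum_comm]
  simp [mul_comm]

theorem le_homDist_of_norm_sum_eq {q n : ℕ} [NeZero q] {u v : Fin n → ZMod q}
    (h : ‖∑ j, ZMod.stdAddChar (u j - v j)‖ ^ 2 = n) :
    (Nat.totient q : ℝ) * (n - Real.sqrt n) ≤ homDist q n u v := by
  have hre (a : (ZMod q)ˣ) :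
      (∑ j, ZMod.stdAddChar ((a : ZMod q) * (u j - v j))).re ≤ Real.sqrt n := by
    refine (Complex.re_le_norm _).trans (Real.le_sqrt_of_sq_le ?_)
    exact (norm_sq_sum_stdAddChar_unit_mul (fun j => u j - v j) h a).le
  have hsum := Finset.sum_le_sum fun a (_ : a ∈ Finset.univ) => hre a
  rw [Finset.sum_const, Finset.card_univ, ZMod.card_units_eq_totient, nsmul_eq_mul] at hsum
  rw [homDist_eq]
  linarith

theorem le_covRad {q n : ℕ} [NeZero q] {C : Set (Fin n → ZMod q)} (hC : C.Nonempty)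
    {r : ℝ} (x : Fin n → ZMod q) (h : ∀ c ∈ C, r ≤ homDist q n x c) : r ≤ covRad q n C := by
  have := hC.to_subtype
  exact (le_ciInf fun c : C => h c c.2).trans
    (le_ciSup (f := fun y => ⨅ c : C, homDist q n y c) (Set.finite_range _).bddAbove x)

/-- if `H ∈ BH(n,q)` and `𝐱` (with entries `q`-th roots of unity,
logarithmic form `Lx`) is a bent vector for `H` with root-of-unity dual, then every
codeword of `C_H` is at scaled homogeneous distance at least `φ(q)(n − √n)` from
`L(𝐱)`, and hence `r(C_H) ≥ φ(q)(n − √n)`. -/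
theorem covRad_BHCode_lower_bound (q n : ℕ) (hq : 1 < q) [NeZero q] (hn : 0 < n)
    (H : Matrix (Fin n) (Fin n) ℂ)
    (LH : Fin n → Fin n → ZMod q) (hLH : ∀ i j, H i j = zetaPow q (LH i j))
    (hHad : H * H.conjTranspose = (n : ℂ) • 1)
    (x : Fin n → ℂ) (Lx : Fin n → ZMod q) (hLx : ∀ i, x i = zetaPow q (Lx i))
    (hbent : ∀ i : Fin n, ∃ ζ : ℂ, ζ ^ q = 1 ∧
      ∑ j, x j * (starRingEnd ℂ) (H i j) = Real.sqrt n * ζ) :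
    (∀ c ∈ BHCode q n LH,
      (Nat.totient q : ℝ) * (n - Real.sqrt n) ≤ homDist q n Lx c) ∧
    (Nat.totient q : ℝ) * (n - Real.sqrt n) ≤ covRad q n (BHCode q n LH) := by
  have hdist : ∀ c ∈ BHCode q n LH,
      (Nat.totient q : ℝ) * (n - Real.sqrt n) ≤ homDist q n Lx c := by
    rintro _ ⟨i, α, rfl⟩
    apply le_homDist_of_norm_sum_eq
    obtain ⟨ζ, hζ, hsum⟩ := hbent i
    have hfactor : ∑ j, ZMod.stdAddChar (Lx j - (LH i j + α)) =
        ZMod.stdAddChar (-α) * (Real.sqrt n * ζ) := by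
      rw [← hsum, Finset.mul_sum]
      refine Finset.sum_congr rfl fun j _ => ?_
      rw [hLx, hLH, zetaPow_eq_stdAddChar, zetaPow_eq_stdAddChar, ← AddChar.map_neg_eq_conj,
        ← AddChar.map_add_eq_mul, ← AddChar.map_add_eq_mul]
      congr 1
      ring
    rw [hfactor, norm_mul, norm_mul, AddChar.norm_apply,
      Complex.norm_eq_one_of_pow_eq_one hζ (NeZero.ne q), one_mul, mul_one, Complex.norm_real,
      Real.norm_eq_abs, sq_abs, Real.sq_sqrt n.cast_nonneg]
  have hC : (BHCode q n LH).Nonempty := ⟨fun j => LH ⟨0, hn⟩ j + 0, ⟨0, hn⟩, 0, rfl⟩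
  exact ⟨hdist, le_covRad hC Lx hdist⟩
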